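/- arXiv:2605.26698 — 5 statements merged into one kernel-verified Lean document; each statement's English description precedes it below -/
import Mathlib

section
/- Let L be a complete lattice and F : L → L a monotone function. Define the parameterized greatest fixed point G_F(H) := gfp (fun X => F (X ⊔ H)). Then for all X, H, H' ∈ L, if X ≤ H' and H' ≤ G_F(H' ⊔ H), then X ≤ G_F(H). -/
namespace AFS

/-- Greatest fixed point (Knaster–Tarski): for a monotone `f`, this is the
greatest fixed point of `f`. -/
def gfp {α : Type*} [CompleteLattice α] (f : α → α) : α := sSup {a | a ≤ f a}

/-- Least fixed point (Knaster–Tarski): for a monotone `f`, this is the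
least fixed point of `f`. -/
def lfp {α : Type*} [CompleteLattice α] (f : α → α) : α := sInf {a | f a ≤ a}

variable {E S S1 S2 : Type*}

/-- `ρ` is a run of the transition relation `step` from state `s` over the infinite word `τ`. -/
def IsRun (step : S → E → S → Prop) (s : S) (τ : ℕ → E) (ρ : ℕ → S) : Prop :=
  ρ 0 = s ∧ ∀ n, step (ρ n) (τ n) (ρ (n + 1))

/-- Büchi language of a state: words admitting a run visiting `F` infinitely often. -/
def Lang (step : S → E → S → Prop) (F : Set S) (s : S) : Set (ℕ → E) :=
  {τ | ∃ ρ, IsRun step s τ ρ ∧ {n | ρ n ∈ F}.Infinite}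

/-- Traces of a state: words admitting a run (no acceptance requirement). -/
def Traces (step : S → E → S → Prop) (s : S) : Set (ℕ → E) :=
  {τ | ∃ ρ, IsRun step s τ ρ}

/-- One-step matching operator on relations. -/
def Match (step1 : S1 → E → S1 → Prop) (step2 : S2 → E → S2 → Prop)
    (X : S1 → S2 → Prop) : S1 → S2 → Prop :=
  fun s1 s2 => ∀ e s1', step1 s1 e s1' → ∃ s2', step2 s2 e s2' ∧ X s1' s2'

theorem gfp_le_map {α : Type*} [CompleteLattice α] {f : α → α} (hf : Monotone f) :
    gfp f ≤ f (gfp f) :=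
  sSup_le fun _ ha => le_trans ha (hf (le_sSup ha))

/-- If `X ≤ H'` and `H' ≤ G_F(H' ⊔ H)`, then `X ≤ G_F(H)`, where
`G_F(H) = gfp (fun X => F (X ⊔ H))` is the parameterized greatest fixed point. -/
theorem stmt0 {L : Type*} [CompleteLattice L] (F : L → L) (hF : Monotone F)
    (X H H' : L) (h1 : X ≤ H')
    (h2 : H' ≤ gfp (fun Y => F (Y ⊔ (H' ⊔ H)))) :
    X ≤ gfp (fun Y => F (Y ⊔ H)) := by
  have hmono : Monotone fun Y => F (Y ⊔ (H' ⊔ H)) :=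
    fun _ _ h => hF (sup_le_sup_right h _)
  refine (h1.trans h2).trans (le_sSup ((gfp_le_map hmono).trans (hF ?_)))
  exact sup_le le_sup_left (sup_le_sup_right h2 H)

end AFS
end

section
/- Incompleteness of direct simulation: let E be a one-element event type {a}, and let A1 and A2 both have state space Bool with the unique transitions step s a (¬s) for each state s, where A1 has accepting set F1 = {false} and A2 has accepting set F2 = {true}. Then L_{A1}(false) ⊆ L_{A2}(false), but there is no direct simulation R : Bool → Bool → Prop (between A1 and A2) with R false false. -/
namespace AFS

variable {E S S1 S2 : Type*}

/-- `R` is a direct simulation of `(step1, F1)` by `(step2, F2)`. -/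
def DirectSim (step1 : S1 → E → S1 → Prop) (F1 : Set S1)
    (step2 : S2 → E → S2 → Prop) (F2 : Set S2) (R : S1 → S2 → Prop) : Prop :=
  ∀ s1 s2, R s1 s2 → (s1 ∈ F1 → s2 ∈ F2) ∧
    ∀ e s1', step1 s1 e s1' → ∃ s2', step2 s2 e s2' ∧ R s1' s2'

/-- The transition relation flipping the boolean state on the unique event. -/
def flipStep : Bool → Unit → Bool → Prop := fun s _ s' => s' = !s

/-- Incompleteness of direct simulation: the two alternating automata are
language included, but no direct simulation relates their initial states. -/
theorem stmt3 :
    Lang flipStep ({false} : Set Bool) false ⊆ Lang flipStep ({true} : Set Bool) false ∧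
    ¬ ∃ R : Bool → Bool → Prop,
        DirectSim flipStep ({false} : Set Bool) flipStep ({true} : Set Bool) R ∧
        R false false := by
  refine ⟨?_, fun ⟨R, hR, h⟩ => by simpa using (hR _ _ h).1 rfl⟩
  rintro τ ⟨ρ, hρ, hinf⟩
  refine ⟨ρ, hρ, (hinf.image (Nat.succ_injective.injOn)).mono ?_⟩
  rintro _ ⟨n, hn, rfl⟩
  have hn : ρ n = false := hn
  have hstep : ρ (n + 1) = !ρ n := hρ.2 n
  simp [hstep, hn]

end AFS
end

section
/- Let A1 = (S1, step1, F1) and A2 = (S2, step2, F2) be Büchi automata over the same event type E. If fsimL_delay s1 s2 holds, then for every event e and every transition step1 s1 e s1' there exists s2' with step2 s2 e s2' and fsimL_delay s1' s2'. -/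
namespace AFS

variable {E S S1 S2 : Type*}

/-- Inductive part of delay simulation: reach a right-accepting state, then pass to `X`. -/
def fsimRdelay (step1 : S1 → E → S1 → Prop) (step2 : S2 → E → S2 → Prop)
    (F2 : Set S2) (X : S1 → S2 → Prop) : S1 → S2 → Prop :=
  lfp (fun Y =>
    (fun s1 s2 => s2 ∈ F2 ∧ Match step1 step2 X s1 s2) ⊔ Match step1 step2 Y)

/-- Functor underlying delay simulation. -/
def fsimLdelayF (step1 : S1 → E → S1 → Prop) (F1 : Set S1)
    (step2 : S2 → E → S2 → Prop) (F2 : Set S2)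
    (X : S1 → S2 → Prop) : S1 → S2 → Prop :=
  fsimRdelay step1 step2 F2 X ⊔ (fun s1 s2 => s1 ∉ F1 ∧ Match step1 step2 X s1 s2)

/-- Delay simulation. -/
def fsimLdelay (step1 : S1 → E → S1 → Prop) (F1 : Set S1)
    (step2 : S2 → E → S2 → Prop) (F2 : Set S2) : S1 → S2 → Prop :=
  gfp (fsimLdelayF step1 F1 step2 F2)

theorem lfp_eq_of_monotone {α : Type*} [CompleteLattice α] {f : α → α} (hf : Monotone f) :
    f (lfp f) = lfp f :=
  OrderHom.map_lfp ⟨f, hf⟩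

theorem gfp_eq_of_monotone {α : Type*} [CompleteLattice α] {f : α → α} (hf : Monotone f) :
    f (gfp f) = gfp f :=
  OrderHom.map_gfp ⟨f, hf⟩

theorem lfp_mono {α : Type*} [CompleteLattice α] {f g : α → α} (h : f ≤ g) : lfp f ≤ lfp g :=
  sInf_le_sInf fun a ha => (h a).trans ha

theorem match_mono (step1 : S1 → E → S1 → Prop) (step2 : S2 → E → S2 → Prop) :
    Monotone (Match step1 step2) := by
  intro X Y hXY s1 s2 h e s1' hs
  obtain ⟨s2', hs2, hX⟩ := h e s1' hs
  exact ⟨s2', hs2, hXY _ _ hX⟩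

theorem fsimRdelay_mono (step1 : S1 → E → S1 → Prop) (step2 : S2 → E → S2 → Prop)
    (F2 : Set S2) : Monotone (fsimRdelay step1 step2 F2) := fun _ _ hXY =>
  lfp_mono fun _ => sup_le_sup_right
    (fun s1 s2 h => ⟨h.1, match_mono step1 step2 hXY s1 s2 h.2⟩) _

theorem fsimRdelay_unfold (step1 : S1 → E → S1 → Prop) (step2 : S2 → E → S2 → Prop)
    (F2 : Set S2) (X : S1 → S2 → Prop) :
    (fun s1 s2 => s2 ∈ F2 ∧ Match step1 step2 X s1 s2) ⊔
      Match step1 step2 (fsimRdelay step1 step2 F2 X) = fsimRdelay step1 step2 F2 X :=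
  lfp_eq_of_monotone (f := fun Y =>
    (fun s1 s2 => s2 ∈ F2 ∧ Match step1 step2 X s1 s2) ⊔ Match step1 step2 Y)
    fun _ _ h => sup_le_sup_left (match_mono step1 step2 h) _

theorem fsimLdelayF_mono (step1 : S1 → E → S1 → Prop) (F1 : Set S1)
    (step2 : S2 → E → S2 → Prop) (F2 : Set S2) :
    Monotone (fsimLdelayF step1 F1 step2 F2) := fun _ _ hXY =>
  sup_le_sup (fsimRdelay_mono step1 step2 F2 hXY)
    fun s1 s2 h => ⟨h.1, match_mono step1 step2 hXY s1 s2 h.2⟩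

theorem fsimLdelay_unfold (step1 : S1 → E → S1 → Prop) (F1 : Set S1)
    (step2 : S2 → E → S2 → Prop) (F2 : Set S2) :
    fsimLdelayF step1 F1 step2 F2 (fsimLdelay step1 F1 step2 F2) =
      fsimLdelay step1 F1 step2 F2 :=
  gfp_eq_of_monotone (fsimLdelayF_mono step1 F1 step2 F2)

/-- Delay simulation is closed under one synchronized step. -/
theorem stmt6 (step1 : S1 → E → S1 → Prop) (F1 : Set S1)
    (step2 : S2 → E → S2 → Prop) (F2 : Set S2)
    (s1 : S1) (s2 : S2) (h : fsimLdelay step1 F1 step2 F2 s1 s2) :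
    ∀ e s1', step1 s1 e s1' →
      ∃ s2', step2 s2 e s2' ∧ fsimLdelay step1 F1 step2 F2 s1' s2' := by
  have hR : fsimRdelay step1 step2 F2 (fsimLdelay step1 F1 step2 F2) ≤
      fsimLdelay step1 F1 step2 F2 :=
    le_sup_left.trans (fsimLdelay_unfold step1 F1 step2 F2).le
  rw [← fsimLdelay_unfold] at h
  rcases h with h | h
  · rw [← fsimRdelay_unfold] at h
    rcases h with h | h
    · exact h.2
    · exact match_mono step1 step2 hR s1 s2 h
  · exact h.2

end AFS
end

section
/- Unsoundness of the merged delay relation: let E be a one-element event type {a}. Let A1 have state space Bool with transitions step1 s a (¬s) and accepting set F1 = {false}, and let A2 have a single state r0 with the self-loop step2 r0 a r0 and accepting set F2 = ∅. Define wrong := gfp (fun X => lfp (fun Y => (fun s1 s2 => s2 ∈ F2 ∧ Match(X) s1 s2) ⊔ Match(Y) ⊔ (fun s1 s2 => s1 ∉ F1 ∧ Match(X) s1 s2))). Then (false, r0) ∈ wrong, yet the constant word a^ω lies in L_{A1}(false) and L_{A2}(r0) = ∅; in particular L_{A1}(false) ⊄ L_{A2}(r0). -/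
namespace AFS

variable {E S S1 S2 : Type*}

/-- Right automaton: a single state with a self-loop. -/
def loopStep : Unit → Unit → Unit → Prop := fun _ _ _ => True

/-- The unsound merged delay relation. -/
def wrong : Bool → Unit → Prop :=
  gfp (fun X => lfp (fun Y =>
    (fun s1 s2 => s2 ∈ (∅ : Set Unit) ∧ Match flipStep loopStep X s1 s2) ⊔
    Match flipStep loopStep Y ⊔
    (fun s1 s2 => s1 ∉ ({false} : Set Bool) ∧ Match flipStep loopStep X s1 s2)))

/-- The merged delay relation relates every pair of states of the two automata. -/
theorem wrong_eq_top : wrong = ⊤ := by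
  refine top_le_iff.mp (le_sSup ?_)
  change (⊤ : Bool → Unit → Prop) ≤ lfp _
  refine le_sInf fun Y hY => ?_
  have h_true : Y true () := hY true () (Or.inr ⟨by simp, fun _ _ _ => ⟨(), trivial, trivial⟩⟩)
  have h_false : Y false () := by
    refine hY false () (Or.inl (Or.inr ?_))
    rintro _ _ rfl
    exact ⟨(), trivial, h_true⟩
  rintro (_ | _) _ _
  exacts [h_false, h_true]

/-- The flipping automaton accepts the constant word from its accepting state. -/
theorem const_mem_lang_flipStep :
    (fun _ : ℕ => ()) ∈ Lang flipStep ({false} : Set Bool) false := by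
  refine ⟨fun n => n.bodd, ⟨rfl, fun n => Nat.bodd_succ n⟩, ?_⟩
  refine Set.infinite_of_injective_forall_mem (f := fun n : ℕ => 2 * n)
    (fun a b h => by simpa using h) fun n => ?_
  simp

/-- No word is accepted when there are no accepting states. -/
theorem lang_empty (step : S → E → S → Prop) (s : S) : Lang step ∅ s = ∅ := by
  refine Set.eq_empty_of_forall_notMem ?_
  rintro τ ⟨ρ, _, h⟩
  simp at h

/-- `wrong` relates the initial states, yet the languages are not included:
`a^ω ∈ L_{A1}(false)` while `L_{A2}(r0) = ∅`. -/
theorem stmt11 :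
    wrong false () ∧
    (fun _ : ℕ => ()) ∈ Lang flipStep ({false} : Set Bool) false ∧
    Lang loopStep (∅ : Set Unit) () = ∅ ∧
    ¬ Lang flipStep ({false} : Set Bool) false ⊆ Lang loopStep (∅ : Set Unit) () := by
  refine ⟨by rw [wrong_eq_top]; trivial, const_mem_lang_flipStep, lang_empty _ _, fun h => ?_⟩
  simpa [lang_empty] using h const_mem_lang_flipStep

end AFS
end

section
/- Soundness of right-biased delay simulation: let A1 = (S1, step1, F1) and A2 = (S2, step2, F2) be Büchi automata over the same event type E, and define fsim_rb := gfp (fun X => lfp (fun Y => (fun s1 s2 => s2 ∈ F2 ∧ Match(X) s1 s2) ⊔ Match(Y))). If fsim_rb s1 s2 holds, then Traces(s1) ⊆ L_{A2}(s2), i.e., every infinite word admitting a run from s1 in A1 lies in the language of s2 in A2. -/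
namespace AFS

variable {E S S1 S2 : Type*}

/-- Right-biased delay simulation. -/
def fsimRb (step1 : S1 → E → S1 → Prop) (step2 : S2 → E → S2 → Prop)
    (F2 : Set S2) : S1 → S2 → Prop :=
  gfp (fun X => lfp (fun Y =>
    (fun s1 s2 => s2 ∈ F2 ∧ Match step1 step2 X s1 s2) ⊔ Match step1 step2 Y))

/-- `ReachAfter step F τ P k n s`: from `s` at time `n` one can read `τ` for `k` steps to reach a
state of `F`, and take one further step to a state satisfying `P`. -/
def ReachAfter (step : S → E → S → Prop) (F : Set S) (τ : ℕ → E) (P : ℕ → S → Prop) :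
    ℕ → ℕ → S → Prop
  | 0, n, s => s ∈ F ∧ ∃ s', step s (τ n) s' ∧ P (n + 1) s'
  | k + 1, n, s => ∃ s', step s (τ n) s' ∧ ReachAfter step F τ P k (n + 1) s'

theorem lfp_le {α : Type*} [CompleteLattice α] {f : α → α} {b : α} (hb : f b ≤ b) : lfp f ≤ b :=
  sInf_le hb

theorem exists_le_of_gfp {f : (S1 → S2 → Prop) → S1 → S2 → Prop} {s1 : S1} {s2 : S2}
    (h : gfp f s1 s2) : ∃ X, X ≤ f X ∧ X s1 s2 := by
  simpa [gfp, sSup_apply] using h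

/-- If `P` always allows an accepting state to be reached before returning to `P`, then `P` at
time `0` yields an accepting run. -/
theorem mem_lang_of_reachAfter {step : S → E → S → Prop} {F : Set S} {τ : ℕ → E}
    {P : ℕ → S → Prop} (hP : ∀ n s, P n s → ∃ k, ReachAfter step F τ P k n s)
    {s : S} (hs : P 0 s) : τ ∈ Lang step F s := by
  have next : ∀ n (p : S × ℕ), ReachAfter step F τ P p.2 n p.1 →
      ∃ q : S × ℕ, step p.1 (τ n) q.1 ∧ ReachAfter step F τ P q.2 (n + 1) q.1 ∧
        (p.2 ≠ 0 → p.2 = q.2 + 1) := by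
    rintro n ⟨s, _ | k⟩ h
    · obtain ⟨-, s', hstep, hs'⟩ := h
      obtain ⟨k, hk⟩ := hP _ _ hs'
      exact ⟨(s', k), hstep, hk, by simp⟩
    · obtain ⟨s', hstep, hk⟩ := h
      exact ⟨(s', k), hstep, hk, by simp⟩
  choose! f hstep hreach hdec using next
  obtain ⟨k₀, hk₀⟩ := hP 0 s hs
  let σ : ℕ → S × ℕ := fun n => Nat.rec (s, k₀) f n
  have hσ : ∀ n, ReachAfter step F τ P (σ n).2 n (σ n).1 := by
    intro n
    induction n with
    | zero => exact hk₀
    | succ n ih => exact hreach n (σ n) ih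
  have hzero : ∀ k n, (σ n).2 = k → ∃ m, n ≤ m ∧ (σ m).2 = 0 := by
    intro k
    induction k with
    | zero => exact fun n hn => ⟨n, le_rfl, hn⟩
    | succ k ih =>
      intro n hn
      have hd : (σ n).2 = (σ (n + 1)).2 + 1 := hdec n (σ n) (hσ n) (by omega)
      obtain ⟨m, hm, hm0⟩ := ih (n + 1) (by omega)
      exact ⟨m, by omega, hm0⟩
  refine ⟨fun n => (σ n).1, ⟨rfl, fun n => hstep n (σ n) (hσ n)⟩, ?_⟩
  refine Set.infinite_of_forall_exists_gt fun n => ?_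
  obtain ⟨m, hm, hm0⟩ := hzero _ (n + 1) rfl
  have hr := hσ m
  rw [hm0] at hr
  exact ⟨m, hr.1, hm⟩

/-- Soundness of right-biased delay simulation: every trace of `s1` is in the
language of `s2`. -/
theorem stmt12 (step1 : S1 → E → S1 → Prop) (F1 : Set S1)
    (step2 : S2 → E → S2 → Prop) (F2 : Set S2)
    (s1 : S1) (s2 : S2) (h : fsimRb step1 step2 F2 s1 s2) :
    Traces step1 s1 ⊆ Lang step2 F2 s2 := by
  rintro τ ⟨ρ, rfl, hρ⟩
  obtain ⟨X, hX, hs⟩ := exists_le_of_gfp h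
  refine mem_lang_of_reachAfter (P := fun n s => X (ρ n) s) (fun n s hns => ?_) hs
  refine lfp_le (b := fun t s => ∀ n, ρ n = t →
    ∃ k, ReachAfter step2 F2 τ (fun n s => X (ρ n) s) k n s) ?_ _ _ (hX _ _ hns) n rfl
  rintro _ s (⟨hF, hm⟩ | hm) n rfl
  · exact ⟨0, hF, hm _ _ (hρ n)⟩
  · obtain ⟨s', hstep, hs'⟩ := hm _ _ (hρ n)
    obtain ⟨k, hk⟩ := hs' (n + 1) rfl
    exact ⟨k + 1, s', hstep, hk⟩

end AFS
end
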